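/- Let φ be a Schwartz function with all moments vanishing (so φ ∈ H¹ and Δφ ∈ H¹). With A_t(φ) as below, one has A_t(φ) ≤ C min( t^{1/2} ‖Δφ‖_{H¹}, t^{-1/2} ‖φ‖_{H¹} ). Consequently A_t(φ) → 0 both as t → 0+ and as t → ∞. -/

import Mathlib

open MeasureTheory Metric Real ENNReal Filter

/-- The Gaussian heat kernel `G_t(x) = (4πt)^{-n/2} exp(-|x|²/(4t))` on ℝⁿ. -/
noncomputable def heatKernel (n : ℕ) (t : ℝ) (x : EuclideanSpace ℝ (Fin n)) : ℝ :=
  (4 * π * t) ^ (-(n : ℝ) / 2) * Real.exp (-‖x‖ ^ 2 / (4 * t))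

/-- Heat extension of a scalar function. -/
noncomputable def heatS (n : ℕ) (τ : ℝ) (w : EuclideanSpace ℝ (Fin n) → ℝ)
    (y : EuclideanSpace ℝ (Fin n)) : ℝ :=
  ∫ z, heatKernel n τ (y - z) * w z

/-- The Laplacian of a scalar function on ℝⁿ. -/
noncomputable def lapF (n : ℕ) (φ : EuclideanSpace ℝ (Fin n) → ℝ)
    (x : EuclideanSpace ℝ (Fin n)) : ℝ :=
  ∑ i : Fin n,
    fderiv ℝ (fun z => fderiv ℝ φ z (EuclideanSpace.single i 1)) x (EuclideanSpace.single i 1)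

/-- The `H¹` (Hardy space) norm of a scalar function, via the parabolic nontangential
maximal function of its heat extension. -/
noncomputable def H1s (n : ℕ) (b : EuclideanSpace ℝ (Fin n) → ℝ) : ℝ≥0∞ :=
  ∫⁻ x, ⨆ (t : ℝ) (_ : 0 < t) (y : EuclideanSpace ℝ (Fin n)) (_ : dist y x < Real.sqrt t),
    ENNReal.ofReal |heatS n t b y|

/-- The functional `A_t(φ) = ∫ ( ∫_0^{t/2} ⨍_{B(x,√s)} |e^{(t−s)Δ}Δφ(y)|² ds dy )^{1/2} dx`. -/
noncomputable def Afun (n : ℕ) (t : ℝ) (φ : EuclideanSpace ℝ (Fin n) → ℝ) : ℝ≥0∞ :=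
  ∫⁻ x, (∫⁻ s in Set.Ioo (0 : ℝ) (t / 2),
    (volume (ball x (Real.sqrt s)))⁻¹ *
      ∫⁻ y in ball x (Real.sqrt s),
        ENNReal.ofReal ((heatS n (t - s) (lapF n φ) y) ^ 2)) ^ ((1 : ℝ) / 2)


open scoped InnerProductSpace LineDeriv

lemma heatKernel_pos (n : ℕ) {t : ℝ} (ht : 0 < t) (x : EuclideanSpace ℝ (Fin n)) :
    0 < heatKernel n t x := by
  unfold heatKernel; positivity

@[fun_prop]
lemma continuous_heatKernel (n : ℕ) (t : ℝ) : Continuous (heatKernel n t) := by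
  unfold heatKernel; fun_prop

lemma integral_heatKernel (n : ℕ) {t : ℝ} (ht : 0 < t) : ∫ x, heatKernel n t x = 1 := by
  have h := GaussianFourier.integral_rexp_neg_mul_sq_norm
    (V := EuclideanSpace ℝ (Fin n)) (b := 1 / (4 * t)) (by positivity)
  have e : ∀ x : EuclideanSpace ℝ (Fin n),
      -‖x‖ ^ 2 / (4 * t) = -(1 / (4 * t)) * ‖x‖ ^ 2 := fun x => by ring
  simp only [heatKernel, integral_const_mul, e, h, finrank_euclideanSpace, Fintype.card_fin]
  rw [show π / (1 / (4 * t)) = 4 * π * t by field_simp, ← rpow_add (by positivity)]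
  rw [show -(n : ℝ) / 2 + n / 2 = 0 by ring, Real.rpow_zero]

lemma integrable_heatKernel (n : ℕ) {t : ℝ} (ht : 0 < t) : Integrable (heatKernel n t) :=
  integrable_of_integral_eq_one (integral_heatKernel n ht)

lemma hasFDerivAt_heatKernel (n : ℕ) {t : ℝ} (ht : 0 < t) (x : EuclideanSpace ℝ (Fin n)) :
    HasFDerivAt (heatKernel n t) ((-(1 / (2 * t)) * heatKernel n t x) • innerSL ℝ x) x := by
  have h1 := ((hasStrictFDerivAt_norm_sq x).hasFDerivAt.const_mul (-(1 / (4 * t)))).exp.const_mul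
    ((4 * π * t) ^ (-(n : ℝ) / 2))
  have e : heatKernel n t = fun y : EuclideanSpace ℝ (Fin n) =>
      (4 * π * t) ^ (-(n : ℝ) / 2) * Real.exp (-(1 / (4 * t)) * ‖y‖ ^ 2) := by
    ext y; rw [heatKernel]; congr 2; ring
  rw [e]
  refine h1.congr_fderiv ?_
  ext v
  simp only [nsmul_eq_mul, FunLike.coe_smul, Pi.smul_apply, smul_eq_mul, Nat.cast_ofNat]
  simp
  field_simp
  ring

/-- The semigroup property of the heat kernel, for equal times. -/
lemma integral_heatKernel_mul_heatKernel (n : ℕ) {a : ℝ} (ha : 0 < a)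
    (w : EuclideanSpace ℝ (Fin n)) :
    ∫ z, heatKernel n a (w - z) * heatKernel n a z = heatKernel n (2 * a) w := by
  have key : ∀ z, heatKernel n a (w - z) * heatKernel n a z =
      heatKernel n (2 * a) w * heatKernel n (a / 2) (z - (1 / 2 : ℝ) • w) := by
    intro z
    have hp : -‖w - z‖ ^ 2 / (4 * a) + -‖z‖ ^ 2 / (4 * a) =
        -‖w‖ ^ 2 / (4 * (2 * a)) + -‖z - (1 / 2 : ℝ) • w‖ ^ 2 / (4 * (a / 2)) := by
      rw [norm_sub_sq_real, norm_sub_sq_real, norm_smul, inner_smul_right, real_inner_comm z w]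
      simp only [norm_div, norm_one, Real.norm_ofNat]
      field_simp
      ring
    have hc : (4 * π * (2 * a)) ^ (-(n : ℝ) / 2) * (4 * π * (a / 2)) ^ (-(n : ℝ) / 2) =
        (4 * π * a) ^ (-(n : ℝ) / 2) * (4 * π * a) ^ (-(n : ℝ) / 2) := by
      rw [← mul_rpow (by positivity) (by positivity), ← mul_rpow (by positivity) (by positivity)]
      congr 1; ring
    unfold heatKernel
    rw [mul_mul_mul_comm, ← Real.exp_add, hp, ← hc, Real.exp_add, mul_mul_mul_comm]
  simp_rw [key, integral_const_mul]
  rw [integral_sub_right_eq_self (fun z => heatKernel n (a / 2) z), integral_heatKernel n (by positivity),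
    mul_one]

/-- The Laplacian of the heat kernel. -/
noncomputable def lapHeatKernel (n : ℕ) (t : ℝ) (x : EuclideanSpace ℝ (Fin n)) : ℝ :=
  (‖x‖ ^ 2 / (4 * t ^ 2) - n / (2 * t)) * heatKernel n t x

@[fun_prop]
lemma continuous_lapHeatKernel (n : ℕ) (t : ℝ) : Continuous (lapHeatKernel n t) := by
  unfold lapHeatKernel; fun_prop

lemma exp_div_mul_heatKernel (n : ℕ) {a : ℝ} (ha : 0 < a) (p : EuclideanSpace ℝ (Fin n)) :
    Real.exp (‖p‖ ^ 2 / (8 * a)) * heatKernel n a p =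
      (4 * π * a) ^ (-(n : ℝ) / 2) * Real.exp (-‖p‖ ^ 2 / (8 * a)) := by
  rw [heatKernel, mul_left_comm, ← Real.exp_add]
  congr 2
  field_simp
  ring

lemma abs_lapHeatKernel_le (n : ℕ) {a : ℝ} (ha : 0 < a) (p : EuclideanSpace ℝ (Fin n)) :
    |lapHeatKernel n a p| ≤
      (n + 4) / (2 * a) * ((4 * π * a) ^ (-(n : ℝ) / 2) * Real.exp (-‖p‖ ^ 2 / (8 * a))) := by
  rw [← exp_div_mul_heatKernel n ha, lapHeatKernel, abs_mul, abs_of_pos (heatKernel_pos n ha p),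
    ← mul_assoc]
  refine mul_le_mul_of_nonneg_right ?_ (heatKernel_pos n ha p).le
  set q := ‖p‖ ^ 2 / (8 * a) with hq
  have hq0 : 0 ≤ q := by positivity
  have h1 : q + 1 ≤ Real.exp q := Real.add_one_le_exp q
  have e : ‖p‖ ^ 2 / (4 * a ^ 2) = 4 / (2 * a) * q := by rw [hq]; field_simp; ring
  have e2 : (n : ℝ) / (2 * a) = 1 / (2 * a) * n := by ring
  have e3 : (n + 4 : ℝ) / (2 * a) * Real.exp q = 1 / (2 * a) * ((n + 4) * Real.exp q) := by ring
  rw [e, e2, e3, show 4 / (2 * a) * q = 1 / (2 * a) * (4 * q) by ring, ← mul_sub, abs_mul,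
    abs_of_pos (by positivity : 0 < 1 / (2 * a))]
  refine mul_le_mul_of_nonneg_left ?_ (by positivity)
  have hn0 : (0 : ℝ) ≤ n := n.cast_nonneg
  rw [abs_le]
  constructor <;> nlinarith [mul_nonneg hn0 hq0, mul_le_mul_of_nonneg_left h1 hn0]

/-- The Laplacian of a Schwartz function, as a Schwartz function. -/
lemma lapF_eq_sum_lineDeriv (n : ℕ) (φ : SchwartzMap (EuclideanSpace ℝ (Fin n)) ℝ) :
    lapF n φ = (∑ i : Fin n, ∂_{EuclideanSpace.single i (1 : ℝ)}
      (∂_{EuclideanSpace.single i (1 : ℝ)} φ) : SchwartzMap (EuclideanSpace ℝ (Fin n)) ℝ) := by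
  ext x
  have e : ∀ i : Fin n, (fun z => fderiv ℝ φ z (EuclideanSpace.single i 1)) =
      (∂_{EuclideanSpace.single i (1 : ℝ)} φ : SchwartzMap (EuclideanSpace ℝ (Fin n)) ℝ) := by
    intro i; ext z; rw [SchwartzMap.lineDerivOp_apply_eq_fderiv]
  simp [lapF, e, SchwartzMap.lineDerivOp_apply_eq_fderiv]

lemma integral_lineDeriv_eq_zero (n : ℕ) (φ : SchwartzMap (EuclideanSpace ℝ (Fin n)) ℝ)
    (v : EuclideanSpace ℝ (Fin n)) : ∫ x, (∂_{v} φ) x = 0 := by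
  have h := integral_mul_fderiv_eq_neg_fderiv_mul_of_integrable (μ := volume)
    (f := fun _ : EuclideanSpace ℝ (Fin n) => (1 : ℝ)) (g := φ) (v := v)
    (by simp) (by simpa [SchwartzMap.lineDerivOp_apply_eq_fderiv] using (∂_{v} φ).integrable)
    (by simpa using φ.integrable) (by simp) (fun x _ => φ.differentiableAt)
  simpa [SchwartzMap.lineDerivOp_apply_eq_fderiv] using h

lemma integral_lapF_eq_zero (n : ℕ) (φ : SchwartzMap (EuclideanSpace ℝ (Fin n)) ℝ) :
    ∫ x, lapF n φ x = 0 := by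
  rw [lapF_eq_sum_lineDeriv]
  simp only [sum_apply]
  rw [integral_finsetSum _ (fun i _ => SchwartzMap.integrable _)]
  simp [integral_lineDeriv_eq_zero]

lemma norm_sq_mul_heatKernel_le (n : ℕ) {a : ℝ} (ha : 0 < a) (p : EuclideanSpace ℝ (Fin n)) :
    ‖p‖ ^ 2 * heatKernel n a p ≤ 4 * a * (4 * π * a) ^ (-(n : ℝ) / 2) := by
  have h1 := Real.add_one_le_exp (‖p‖ ^ 2 / (4 * a))
  have h2 : ‖p‖ ^ 2 ≤ 4 * a * Real.exp (‖p‖ ^ 2 / (4 * a)) := by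
    have : ‖p‖ ^ 2 = 4 * a * (‖p‖ ^ 2 / (4 * a)) := by field_simp
    nlinarith
  have h3 := mul_le_mul_of_nonneg_right h2 (heatKernel_pos n ha p).le
  refine h3.trans_eq ?_
  have h4 : Real.exp (‖p‖ ^ 2 / (4 * a)) * Real.exp (-‖p‖ ^ 2 / (4 * a)) = 1 := by
    rw [← Real.exp_add, neg_div, add_neg_cancel, Real.exp_zero]
  rw [heatKernel]
  linear_combination (4 * a * (4 * π * a) ^ (-(n : ℝ) / 2)) * h4

lemma heatKernel_le (n : ℕ) {a : ℝ} (ha : 0 < a) (p : EuclideanSpace ℝ (Fin n)) :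
    heatKernel n a p ≤ (4 * π * a) ^ (-(n : ℝ) / 2) := by
  rw [heatKernel]
  refine mul_le_of_le_one_right (by positivity) (Real.exp_le_one_iff.2 ?_)
  rw [neg_div]
  have : 0 ≤ ‖p‖ ^ 2 / (4 * a) := by positivity
  linarith

lemma exists_bound_one_add_norm_sq_mul_heatKernel (n : ℕ) {a : ℝ} (ha : 0 < a) :
    ∃ C, ∀ p : EuclideanSpace ℝ (Fin n), (1 + ‖p‖ ^ 2) * heatKernel n a p ≤ C :=
  ⟨_, fun p => by
    rw [add_mul, one_mul]
    exact add_le_add (heatKernel_le n ha p) (norm_sq_mul_heatKernel_le n ha p)⟩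

lemma SchwartzMap.integrable_bdd_mul {n : ℕ} {f : EuclideanSpace ℝ (Fin n) → ℝ}
    (hf : Continuous f) {C : ℝ} (hC : ∀ x, |f x| ≤ C)
    (ψ : SchwartzMap (EuclideanSpace ℝ (Fin n)) ℝ) : Integrable (fun x => f x * ψ x) :=
  ψ.integrable.bdd_mul hf.aestronglyMeasurable (Eventually.of_forall hC)

/-- Integration by parts in one coordinate, against a translated reflected heat kernel. -/
lemma integral_heatKernel_mul_lineDeriv_lineDeriv (n : ℕ) {a : ℝ} (ha : 0 < a)
    (φ : SchwartzMap (EuclideanSpace ℝ (Fin n)) ℝ) (y : EuclideanSpace ℝ (Fin n)) (i : Fin n) :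
    Integrable (fun z => ((y i - z i) ^ 2 / (4 * a ^ 2) - 1 / (2 * a)) *
      heatKernel n a (y - z) * φ z) ∧
    ∫ z, heatKernel n a (y - z) * (∂_{EuclideanSpace.single i (1 : ℝ)}
      (∂_{EuclideanSpace.single i (1 : ℝ)} φ)) z =
    ∫ z, (((y i - z i) ^ 2 / (4 * a ^ 2) - 1 / (2 * a)) * heatKernel n a (y - z)) * φ z := by
  set e : EuclideanSpace ℝ (Fin n) := EuclideanSpace.single i (1 : ℝ) with he
  obtain ⟨C, hC⟩ := exists_bound_one_add_norm_sq_mul_heatKernel n ha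
  have hcoord : ∀ z : EuclideanSpace ℝ (Fin n), |y i - z i| ≤ ‖y - z‖ := fun z => by
    simpa using PiLp.norm_apply_le (y - z) i
  let B : ℝ →L[ℝ] ℝ →L[ℝ] ℝ := ContinuousLinearMap.mul ℝ ℝ
  let f0 : EuclideanSpace ℝ (Fin n) → ℝ := fun z => heatKernel n a (y - z)
  let f1 : EuclideanSpace ℝ (Fin n) → ℝ := fun z =>
    (y i - z i) / (2 * a) * heatKernel n a (y - z)
  let f2 : EuclideanSpace ℝ (Fin n) → ℝ := fun z =>
    ((y i - z i) ^ 2 / (4 * a ^ 2) - 1 / (2 * a)) * heatKernel n a (y - z)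
  have hc0 : Continuous f0 := by fun_prop
  have hc1 : Continuous f1 := by fun_prop
  have hc2 : Continuous f2 := by fun_prop
  have hK0 : ∀ z, 0 < heatKernel n a (y - z) := fun z => heatKernel_pos n ha _
  have hb0 : ∀ z, |f0 z| ≤ C := fun z => by
    rw [abs_of_pos (hK0 z)]
    nlinarith [hC (y - z), mul_nonneg (sq_nonneg ‖y - z‖) (hK0 z).le]
  have hb1 : ∀ z, |f1 z| ≤ 1 / (2 * a) * C := fun z => by
    have h : |y i - z i| ≤ 1 + ‖y - z‖ ^ 2 := by nlinarith [hcoord z, sq_nonneg (‖y - z‖ - 1)]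
    simp only [f1]
    rw [abs_mul, abs_of_pos (hK0 z), abs_div, abs_of_pos (by positivity : 0 < 2 * a), div_mul_eq_mul_div,
      div_mul_eq_mul_div, one_mul]
    gcongr
    exact (mul_le_mul_of_nonneg_right h (hK0 z).le).trans (hC _)
  have hb2 : ∀ z, |f2 z| ≤ (1 / (4 * a ^ 2) + 1 / (2 * a)) * C := fun z => by
    have h : (y i - z i) ^ 2 ≤ ‖y - z‖ ^ 2 := by
      rw [← sq_abs (y i - z i)]; gcongr; exact hcoord z
    simp only [f2]
    rw [abs_mul, abs_of_pos (hK0 z)]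
    have h2 : |(y i - z i) ^ 2 / (4 * a ^ 2) - 1 / (2 * a)| ≤
        (1 / (4 * a ^ 2) + 1 / (2 * a)) * (1 + ‖y - z‖ ^ 2) := by
      have h3 : (y i - z i) ^ 2 / (4 * a ^ 2) ≤ 1 / (4 * a ^ 2) * ‖y - z‖ ^ 2 := by
        rw [div_mul_eq_mul_div, one_mul]; gcongr
      have h4 : 0 < 1 / (4 * a ^ 2) := by positivity
      have h5 : 0 < 1 / (2 * a) := by positivity
      have h6 : 0 ≤ (y i - z i) ^ 2 / (4 * a ^ 2) := by positivity
      rw [abs_le]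
      constructor <;> nlinarith [mul_nonneg h4.le (sq_nonneg ‖y - z‖), mul_nonneg h5.le (sq_nonneg ‖y - z‖)]
    calc _ ≤ (1 / (4 * a ^ 2) + 1 / (2 * a)) * (1 + ‖y - z‖ ^ 2) * heatKernel n a (y - z) := by
          gcongr; exact (hK0 z).le
      _ ≤ _ := by rw [mul_assoc]; gcongr; exact hC _
  have hd0 : ∀ z, HasFDerivAt f0 ((1 / (2 * a) * heatKernel n a (y - z)) • innerSL ℝ (y - z)) z := by
    intro z
    refine ((hasFDerivAt_heatKernel n ha (y - z)).comp z
      ((hasFDerivAt_id z).const_sub y)).congr_fderiv ?_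
    ext v; simp
  have hl0 : ∀ z, HasLineDerivAt ℝ f0 (f1 z) z e := by
    intro z
    have h : ((1 / (2 * a) * heatKernel n a (y - z)) • innerSL ℝ (y - z)) e = f1 z := by
      simp [f1, he, EuclideanSpace.inner_single_right]
      ring
    exact h ▸ (hd0 z).hasLineDerivAt e
  have hl1 : ∀ z, HasLineDerivAt ℝ f1 (f2 z) z e := by
    intro z
    have hp : HasFDerivAt (fun z : EuclideanSpace ℝ (Fin n) => (y i - z i) / (2 * a))
        ((2 * a)⁻¹ • (-(EuclideanSpace.proj i : EuclideanSpace ℝ (Fin n) →L[ℝ] ℝ))) z := by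
      have := (((EuclideanSpace.proj i : EuclideanSpace ℝ (Fin n) →L[ℝ] ℝ).hasFDerivAt
        (x := z)).const_sub (y i)).mul_const (2 * a)⁻¹
      simpa [div_eq_mul_inv] using this
    have h := (hp.mul (hd0 z)).hasLineDerivAt e
    refine HasDerivAt.congr_deriv (h : HasDerivAt _ _ _) ?_
    simp [f2, f0, he, EuclideanSpace.inner_single_right]
    field_simp
    ring
  have hg : ∀ (ψ : SchwartzMap (EuclideanSpace ℝ (Fin n)) ℝ) z,
      HasLineDerivAt ℝ ψ ((∂_{e} ψ) z) z e := by
    intro ψ z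
    rw [SchwartzMap.lineDerivOp_apply_eq_fderiv]
    exact ψ.differentiableAt.hasFDerivAt.hasLineDerivAt e
  have s1 := integral_bilinear_hasLineDerivAt_right_eq_neg_left_of_integrable (μ := volume) (B := B)
    (SchwartzMap.integrable_bdd_mul hc1 hb1 (∂_{e} φ))
    (SchwartzMap.integrable_bdd_mul hc0 hb0 (∂_{e} (∂_{e} φ)))
    (SchwartzMap.integrable_bdd_mul hc0 hb0 (∂_{e} φ)) (fun z _ => hl0 z) (fun z _ => hg _ z)
  have s2 := integral_bilinear_hasLineDerivAt_right_eq_neg_left_of_integrable (μ := volume) (B := B)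
    (SchwartzMap.integrable_bdd_mul hc2 hb2 φ)
    (SchwartzMap.integrable_bdd_mul hc1 hb1 (∂_{e} φ))
    (SchwartzMap.integrable_bdd_mul hc1 hb1 φ) (fun z _ => hl1 z) (fun z _ => hg _ z)
  exact ⟨SchwartzMap.integrable_bdd_mul hc2 hb2 φ, s1.trans (by rw [s2, neg_neg]; rfl)⟩

lemma integrable_lapHeatKernel (n : ℕ) {a : ℝ} (ha : 0 < a) : Integrable (lapHeatKernel n a) := by
  have h := ((integrable_heatKernel n (by positivity : 0 < 2 * a)).const_mul
    ((4 * π * (2 * a)) ^ (-(n : ℝ) / 2))⁻¹).const_mul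
      ((n + 4) / (2 * a) * (4 * π * a) ^ (-(n : ℝ) / 2))
  refine h.mono' (continuous_lapHeatKernel n a).aestronglyMeasurable (Eventually.of_forall ?_)
  intro p
  have hc : (4 * π * (2 * a)) ^ (-(n : ℝ) / 2) ≠ 0 := by positivity
  refine (abs_lapHeatKernel_le n ha p).trans_eq ?_
  rw [heatKernel, inv_mul_cancel_left₀ hc, show 4 * (2 * a) = 8 * a by ring]
  ring

lemma exists_abs_lapHeatKernel_le (n : ℕ) {a : ℝ} (ha : 0 < a) :
    ∃ C, ∀ p, |lapHeatKernel n a p| ≤ C :=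
  ⟨_, fun p => (abs_lapHeatKernel_le n ha p).trans (mul_le_mul_of_nonneg_left
    (mul_le_of_le_one_right (by positivity) (Real.exp_le_one_iff.2 (by
      rw [neg_div]
      exact neg_nonpos.2 (by positivity)))) (by positivity))⟩

/-- Associativity of convolution, for a bounded continuous function and two integrable ones. -/
lemma integral_mul_integral_mul_eq {n : ℕ} {f g k : EuclideanSpace ℝ (Fin n) → ℝ}
    (hf : Continuous f) {C : ℝ} (hC : ∀ x, |f x| ≤ C) (hg : Integrable g) (hk : Integrable k)
    (y : EuclideanSpace ℝ (Fin n)) :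
    ∫ z, f (y - z) * ∫ w, g (z - w) * k w = ∫ w, (∫ z, f (y - w - z) * g z) * k w := by
  have hint : Integrable (fun p : EuclideanSpace ℝ (Fin n) × EuclideanSpace ℝ (Fin n) =>
      f (y - p.1) * (g (p.1 - p.2) * k p.2)) (volume.prod volume) := by
    have h := Integrable.convolution_integrand (ContinuousLinearMap.mul ℝ ℝ) hk hg
    refine Integrable.bdd_mul (c := C) ?_ (by fun_prop) (Eventually.of_forall fun p => hC _)
    exact h.congr (Eventually.of_forall fun p => by simp [mul_comm])
  calc ∫ z, f (y - z) * ∫ w, g (z - w) * k w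
      = ∫ z, ∫ w, f (y - z) * (g (z - w) * k w) := by simp_rw [integral_const_mul]
    _ = ∫ w, ∫ z, f (y - z) * (g (z - w) * k w) := integral_integral_swap hint
    _ = ∫ w, (∫ z, f (y - z) * g (z - w)) * k w := by
      simp_rw [← mul_assoc, integral_mul_const]
    _ = _ := by
      congr 1; ext w; congr 1
      rw [← integral_add_right_eq_self _ w]
      simp [sub_sub, add_comm]

lemma heatS_lapF (n : ℕ) {a : ℝ} (ha : 0 < a)
    (φ : SchwartzMap (EuclideanSpace ℝ (Fin n)) ℝ) (y : EuclideanSpace ℝ (Fin n)) :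
    heatS n a (lapF n φ) y = ∫ z, lapHeatKernel n a (y - z) * φ z := by
  obtain ⟨C, hC⟩ := exists_bound_one_add_norm_sq_mul_heatKernel n ha
  rw [heatS, lapF_eq_sum_lineDeriv]
  simp only [sum_apply, Finset.mul_sum]
  have hb : ∀ z, |heatKernel n a (y - z)| ≤ C := fun z => by
    rw [abs_of_pos (heatKernel_pos n ha _)]
    nlinarith [hC (y - z), mul_nonneg (sq_nonneg ‖y - z‖) (heatKernel_pos n ha (y - z)).le]
  rw [integral_finsetSum _ (fun i _ => SchwartzMap.integrable_bdd_mul (by fun_prop) hb _)]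
  simp_rw [(integral_heatKernel_mul_lineDeriv_lineDeriv n ha φ y _).2]
  rw [← integral_finsetSum]
  · congr 1; ext z
    rw [← Finset.sum_mul, ← Finset.sum_mul, Finset.sum_sub_distrib, ← Finset.sum_div, lapHeatKernel,
      EuclideanSpace.norm_sq_eq]
    simp [div_eq_mul_inv]
  · exact fun i _ => (integral_heatKernel_mul_lineDeriv_lineDeriv n ha φ y i).1

lemma heatS_two_mul_lapF (n : ℕ) {a : ℝ} (ha : 0 < a)
    (φ : SchwartzMap (EuclideanSpace ℝ (Fin n)) ℝ) (y : EuclideanSpace ℝ (Fin n)) :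
    heatS n (2 * a) (lapF n φ) y = ∫ z, lapHeatKernel n a (y - z) * heatS n a φ z := by
  have hG : ∀ x, |heatKernel n a x| ≤ (4 * π * a) ^ (-(n : ℝ) / 2) := fun x => by
    rw [abs_of_pos (heatKernel_pos n ha x)]; exact heatKernel_le n ha x
  obtain ⟨C, hC⟩ := exists_abs_lapHeatKernel_le n ha
  have hψ : Integrable (lapF n φ) := by
    rw [lapF_eq_sum_lineDeriv]; exact SchwartzMap.integrable _
  have e1 := integral_mul_integral_mul_eq (continuous_heatKernel n a) hG
    (integrable_heatKernel n ha) hψ y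
  have e2 := integral_mul_integral_mul_eq (continuous_heatKernel n a) hG
    (integrable_lapHeatKernel n ha) φ.integrable y
  have e3 := integral_mul_integral_mul_eq (continuous_lapHeatKernel n a) hC
    (integrable_heatKernel n ha) φ.integrable y
  have hcomm : ∀ p, ∫ z, lapHeatKernel n a (p - z) * heatKernel n a z =
      ∫ z, heatKernel n a (p - z) * lapHeatKernel n a z := fun p => by
    rw [← integral_sub_left_eq_self _ volume p]
    simp [mul_comm]
  simp_rw [integral_heatKernel_mul_heatKernel n ha] at e1
  simp_rw [hcomm] at e3
  rw [heatS, ← e1]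
  simp_rw [heatS]
  rw [e3, ← e2]
  congr 1; ext z
  rw [← heatS_lapF n ha, heatS]

/-- The nontangential maximal function of the heat extension. -/
noncomputable def heatMaximal (n : ℕ) (b : EuclideanSpace ℝ (Fin n) → ℝ)
    (x : EuclideanSpace ℝ (Fin n)) : ℝ≥0∞ :=
  ⨆ (t : ℝ) (_ : 0 < t) (y : EuclideanSpace ℝ (Fin n)) (_ : dist y x < Real.sqrt t),
    ENNReal.ofReal |heatS n t b y|

lemma H1s_eq_lintegral (n : ℕ) (b : EuclideanSpace ℝ (Fin n) → ℝ) :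
    H1s n b = ∫⁻ x, heatMaximal n b x := rfl

lemma ofReal_abs_heatS_le (n : ℕ) (b : EuclideanSpace ℝ (Fin n) → ℝ) {t : ℝ} (ht : 0 < t)
    {x y : EuclideanSpace ℝ (Fin n)} (hxy : dist y x < Real.sqrt t) :
    ENNReal.ofReal |heatS n t b y| ≤ heatMaximal n b x :=
  le_iSup₂_of_le t ht (le_iSup₂_of_le y hxy le_rfl)

lemma measurable_heatMaximal (n : ℕ) (b : EuclideanSpace ℝ (Fin n) → ℝ) :
    Measurable (heatMaximal n b) := by
  refine LowerSemicontinuous.measurable ?_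
  refine lowerSemicontinuous_iSup fun t => lowerSemicontinuous_iSup fun _ =>
    lowerSemicontinuous_iSup fun y => ?_
  have h : (fun x => ⨆ (_ : dist y x < Real.sqrt t), ENNReal.ofReal |heatS n t b y|) =
      ({x | dist y x < Real.sqrt t} : Set (EuclideanSpace ℝ (Fin n))).indicator
        fun _ => ENNReal.ofReal |heatS n t b y| := by
    ext x
    by_cases hx : dist y x < Real.sqrt t <;> simp [Set.indicator, hx]
  rw [h]
  exact (isOpen_lt (by fun_prop) continuous_const).lowerSemicontinuous_indicator zero_le

/-- A pointwise bound on the heat extension of the Laplacian bounds `Afun`. -/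
lemma Afun_le_of_pointwise (n : ℕ) {t : ℝ} (φ : EuclideanSpace ℝ (Fin n) → ℝ)
    (F : EuclideanSpace ℝ (Fin n) → ℝ≥0∞)
    (hF : ∀ x y s, 0 < s → s < t / 2 → dist y x < Real.sqrt s →
      ENNReal.ofReal |heatS n (t - s) (lapF n φ) y| ≤ F x) :
    Afun n t φ ≤ ENNReal.ofReal (Real.sqrt t) * ∫⁻ x, F x := by
  rw [← lintegral_const_mul' _ _ ENNReal.ofReal_ne_top]
  refine lintegral_mono fun x => ?_
  have inner : ∀ s ∈ Set.Ioo 0 (t / 2), (volume (ball x (Real.sqrt s)))⁻¹ *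
      ∫⁻ y in ball x (Real.sqrt s), ENNReal.ofReal ((heatS n (t - s) (lapF n φ) y) ^ 2) ≤
        F x ^ 2 := by
    intro s hs
    calc _ ≤ (volume (ball x (Real.sqrt s)))⁻¹ * ∫⁻ y in ball x (Real.sqrt s), F x ^ 2 := by
          refine mul_le_mul' le_rfl ?_
          refine setLIntegral_mono' measurableSet_ball fun y hy => ?_
          rw [← sq_abs, ENNReal.ofReal_pow (abs_nonneg _)]
          gcongr
          exact hF x y s hs.1 hs.2 hy
      _ = (volume (ball x (Real.sqrt s)))⁻¹ * volume (ball x (Real.sqrt s)) * F x ^ 2 := by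
          rw [setLIntegral_const]; ring
      _ ≤ 1 * F x ^ 2 := by gcongr; exact ENNReal.inv_mul_le_one _
      _ = _ := one_mul _
  calc _ ≤ (∫⁻ s in Set.Ioo (0 : ℝ) (t / 2), F x ^ 2) ^ ((1 : ℝ) / 2) := by
        gcongr ?_ ^ _
        exact setLIntegral_mono' measurableSet_Ioo inner
    _ = (F x ^ 2 * ENNReal.ofReal (t / 2)) ^ ((1 : ℝ) / 2) := by
        rw [setLIntegral_const, Real.volume_Ioo, sub_zero]
    _ = F x * ENNReal.ofReal (t / 2) ^ ((1 : ℝ) / 2) := by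
        rw [ENNReal.mul_rpow_of_nonneg _ _ (by norm_num), ← ENNReal.rpow_natCast, ← ENNReal.rpow_mul]
        norm_num
    _ ≤ ENNReal.ofReal (Real.sqrt t) * F x := by
        rw [mul_comm]
        gcongr
        rcases le_or_gt t 0 with ht | ht
        · rw [ENNReal.ofReal_of_nonpos (by linarith)]; simp
        rw [Real.sqrt_eq_rpow, ENNReal.ofReal_rpow_of_nonneg (by linarith) (by norm_num)]
        gcongr
        linarith

lemma Afun_le_sqrt_mul_H1s (n : ℕ) {t : ℝ} (φ : EuclideanSpace ℝ (Fin n) → ℝ) :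
    Afun n t φ ≤ ENNReal.ofReal (Real.sqrt t) * H1s n (lapF n φ) :=
  Afun_le_of_pointwise n φ _ fun _ _ _ hs hst hxy =>
    ofReal_abs_heatS_le n _ (by linarith) (hxy.trans_le (Real.sqrt_le_sqrt (by linarith)))

lemma abs_lapHeatKernel_le_heatKernel (n : ℕ) {a t : ℝ} (ht : 0 < t) (ha1 : t / 4 ≤ a)
    (ha2 : a ≤ t / 2) {x y : EuclideanSpace ℝ (Fin n)} (hxy : dist y x ^ 2 ≤ 2 * a)
    (z : EuclideanSpace ℝ (Fin n)) :
    |lapHeatKernel n a (y - z)| ≤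
      (2 * n + 8) * Real.exp (1 / 4) * 8 ^ ((n : ℝ) / 2) / t * heatKernel n (2 * t) (x - z) := by
  have ha : 0 < a := by linarith
  refine (abs_lapHeatKernel_le n ha _).trans ?_
  have h1 : (n + 4 : ℝ) / (2 * a) ≤ (2 * n + 8) / t := by
    rw [div_le_div_iff₀ (by positivity) ht]
    have : (0 : ℝ) ≤ n := n.cast_nonneg
    nlinarith
  have h2 : (4 * π * a) ^ (-(n : ℝ) / 2) ≤ 8 ^ ((n : ℝ) / 2) * (4 * π * (2 * t)) ^ (-(n : ℝ) / 2) := by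
    have : (4 * π * (2 * t)) ^ (-(n : ℝ) / 2) =
        8 ^ (-(n : ℝ) / 2) * (π * t) ^ (-(n : ℝ) / 2) := by
      rw [← Real.mul_rpow (by norm_num) (by positivity)]; congr 1; ring
    rw [this, ← mul_assoc, ← Real.rpow_add (by norm_num), neg_div, add_neg_cancel, Real.rpow_zero,
      one_mul]
    refine Real.rpow_le_rpow_of_nonpos (by positivity) ?_ (neg_nonpos.2 (by positivity))
    nlinarith [Real.pi_pos]
  have h3 : Real.exp (-‖y - z‖ ^ 2 / (8 * a)) ≤
      Real.exp (1 / 4) * Real.exp (-‖x - z‖ ^ 2 / (4 * (2 * t))) := by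
    rw [← Real.exp_add, Real.exp_le_exp]
    have htri : ‖x - z‖ ≤ dist y x + ‖y - z‖ := by
      rw [← dist_eq_norm, ← dist_eq_norm, dist_comm y x]; exact dist_triangle x y z
    have hsq : ‖x - z‖ ^ 2 ≤ 2 * (2 * a) + 2 * ‖y - z‖ ^ 2 := by
      nlinarith [sq_nonneg (dist y x - ‖y - z‖), norm_nonneg (x - z), dist_nonneg (x := y) (y := x),
        norm_nonneg (y - z)]
    have e : -‖y - z‖ ^ 2 / (8 * a) ≤ 1 / 4 - ‖x - z‖ ^ 2 / (16 * a) := by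
      have : ‖y - z‖ ^ 2 / (8 * a) = 2 * ‖y - z‖ ^ 2 / (16 * a) := by field_simp; ring
      have e2 : (1 : ℝ) / 4 = 4 * a / (16 * a) := by field_simp; norm_num
      rw [neg_div, this, e2, ← neg_div, ← sub_div]
      gcongr
      linarith
    have e3 : ‖x - z‖ ^ 2 / (4 * (2 * t)) ≤ ‖x - z‖ ^ 2 / (16 * a) := by
      exact div_le_div_of_nonneg_left (by positivity) (by positivity) (by linarith)
    rw [neg_div (4 * (2 * t))]
    linarith
  calc _ ≤ (2 * n + 8) / t * ((8 ^ ((n : ℝ) / 2) * (4 * π * (2 * t)) ^ (-(n : ℝ) / 2)) *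
        (Real.exp (1 / 4) * Real.exp (-‖x - z‖ ^ 2 / (4 * (2 * t))))) := by gcongr
    _ = _ := by rw [heatKernel]; ring

lemma lintegral_ofReal_heatKernel (n : ℕ) {t : ℝ} (ht : 0 < t) :
    ∫⁻ x, ENNReal.ofReal (heatKernel n t x) = 1 := by
  rw [← ofReal_integral_eq_lintegral_ofReal (integrable_heatKernel n ht)
    (Eventually.of_forall fun x => (heatKernel_pos n ht x).le), integral_heatKernel n ht,
    ENNReal.ofReal_one]

lemma lintegral_lintegral_heatKernel_mul (n : ℕ) {t : ℝ} (ht : 0 < t)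
    {N : EuclideanSpace ℝ (Fin n) → ℝ≥0∞} (hN : Measurable N) :
    ∫⁻ x, ∫⁻ z, ENNReal.ofReal (heatKernel n t (x - z)) * N z = ∫⁻ z, N z := by
  rw [lintegral_lintegral_swap]
  · congr 1; ext z
    rw [lintegral_mul_const _ (by fun_prop),
      lintegral_sub_right_eq_self (fun x => ENNReal.ofReal (heatKernel n t x)),
      lintegral_ofReal_heatKernel n ht, one_mul]
  · refine (Measurable.mul ?_ (hN.comp measurable_snd)).aemeasurable
    exact (by fun_prop : Continuous fun p : EuclideanSpace ℝ (Fin n) × EuclideanSpace ℝ (Fin n) =>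
      heatKernel n t (p.1 - p.2)).measurable.ennreal_ofReal

lemma Afun_le_inv_sqrt_mul_H1s (n : ℕ) {t : ℝ} (ht : 0 < t)
    (φ : SchwartzMap (EuclideanSpace ℝ (Fin n)) ℝ) :
    Afun n t φ ≤ ENNReal.ofReal ((2 * n + 8) * Real.exp (1 / 4) * 8 ^ ((n : ℝ) / 2)) *
      (ENNReal.ofReal ((Real.sqrt t)⁻¹) * H1s n φ) := by
  set K : ℝ := (2 * n + 8) * Real.exp (1 / 4) * 8 ^ ((n : ℝ) / 2) with hK
  have hK0 : 0 < K := by positivity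
  have h := Afun_le_of_pointwise n (t := t) φ (fun x => ENNReal.ofReal (K / t) *
    ∫⁻ z, ENNReal.ofReal (heatKernel n (2 * t) (x - z)) * heatMaximal n φ z) ?_
  · rw [lintegral_const_mul' _ _ ENNReal.ofReal_ne_top,
      lintegral_lintegral_heatKernel_mul n (by positivity) (measurable_heatMaximal n φ)] at h
    refine h.trans_eq ?_
    rw [H1s_eq_lintegral, ← mul_assoc, ← mul_assoc, ← ENNReal.ofReal_mul (by positivity),
      ← ENNReal.ofReal_mul (by positivity)]
    congr 2
    have := Real.sqrt_pos.2 ht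
    field_simp
    rw [Real.sq_sqrt ht.le]
  · intro x y s hs hst hxy
    have ha : 0 < (t - s) / 2 := by linarith
    rw [show t - s = 2 * ((t - s) / 2) by ring, heatS_two_mul_lapF n ha,
      ← Real.norm_eq_abs, ofReal_norm, ← lintegral_const_mul' _ _ ENNReal.ofReal_ne_top]
    refine (enorm_integral_le_lintegral_enorm _).trans (lintegral_mono fun z => ?_)
    have hd : dist y x ^ 2 ≤ 2 * ((t - s) / 2) := by
      have := Real.sq_sqrt hs.le
      have := pow_le_pow_left₀ dist_nonneg hxy.le 2
      linarith
    simp only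
    rw [← mul_assoc, ← ENNReal.ofReal_mul (by positivity), enorm_mul]
    gcongr
    · rw [← ofReal_norm]
      exact ENNReal.ofReal_le_ofReal
        (abs_lapHeatKernel_le_heatKernel n ht (by linarith) (by linarith) hd z)
    · rw [← ofReal_norm]
      exact ofReal_abs_heatS_le n _ ha (by simpa using ha)

lemma one_add_pow_mul_exp_le {q : ℝ} (hq : 0 ≤ q) (m : ℕ) :
    (1 + q) ^ m * Real.exp (-q ^ 2 / 4) ≤ m.factorial * Real.exp 2 := by
  have h1 := Real.pow_div_factorial_le_exp (x := 1 + q) (by positivity) m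
  rw [div_le_iff₀ (by positivity)] at h1
  have h2 : Real.exp (1 + q) * Real.exp (-q ^ 2 / 4) ≤ Real.exp 2 := by
    rw [← Real.exp_add, Real.exp_le_exp]
    nlinarith [sq_nonneg (q / 2 - 1)]
  calc _ ≤ Real.exp (1 + q) * m.factorial * Real.exp (-q ^ 2 / 4) := by gcongr
    _ = m.factorial * (Real.exp (1 + q) * Real.exp (-q ^ 2 / 4)) := by ring
    _ ≤ _ := by gcongr

lemma heatKernel_le_sqrt (n : ℕ) {t : ℝ} (ht : 0 < t) (p : EuclideanSpace ℝ (Fin n)) :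
    heatKernel n t p ≤ (Real.sqrt t ^ n)⁻¹ * Real.exp (-(‖p‖ / Real.sqrt t) ^ 2 / 4) := by
  rw [heatKernel]
  have hσ := Real.sqrt_pos.2 ht
  have h1 : (4 * π * t) ^ (-(n : ℝ) / 2) ≤ (Real.sqrt t ^ n)⁻¹ := by
    have : (Real.sqrt t ^ n)⁻¹ = t ^ (-(n : ℝ) / 2) := by
      rw [Real.sqrt_eq_rpow, ← Real.rpow_natCast, ← Real.rpow_mul ht.le, ← Real.rpow_neg ht.le]
      congr 1; ring
    rw [this]
    refine Real.rpow_le_rpow_of_nonpos ht ?_ ?_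
    · nlinarith [Real.pi_gt_three]
    · rw [neg_div]; exact neg_nonpos.2 (by positivity)
  have h2 : -‖p‖ ^ 2 / (4 * t) = -(‖p‖ / Real.sqrt t) ^ 2 / 4 := by
    rw [div_pow, Real.sq_sqrt ht.le]; field_simp
  rw [h2]
  gcongr

lemma pow_mul_heatKernel_le (n : ℕ) {t R : ℝ} (ht : 0 < t) (hR : 0 ≤ R)
    (p : EuclideanSpace ℝ (Fin n)) (hp : R ≤ Real.sqrt t + ‖p‖) :
    R ^ n * heatKernel n t p ≤ n.factorial * Real.exp 2 := by
  have hσ := Real.sqrt_pos.2 ht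
  set q := ‖p‖ / Real.sqrt t with hq
  have hs : Real.sqrt t + ‖p‖ = Real.sqrt t * (1 + q) := by rw [hq]; field_simp
  calc R ^ n * heatKernel n t p
      ≤ (Real.sqrt t * (1 + q)) ^ n * ((Real.sqrt t ^ n)⁻¹ * Real.exp (-q ^ 2 / 4)) := by
        rw [← hs]
        gcongr
        · exact (heatKernel_pos n ht p).le
        · exact heatKernel_le_sqrt n ht p
    _ = (1 + q) ^ n * Real.exp (-q ^ 2 / 4) := by rw [mul_pow]; field_simp
    _ ≤ _ := one_add_pow_mul_exp_le (by positivity) n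

lemma pow_mul_norm_fderiv_heatKernel_le (n : ℕ) {t R : ℝ} (ht : 0 < t) (hR : 0 ≤ R)
    (p : EuclideanSpace ℝ (Fin n)) (hp : R ≤ Real.sqrt t + ‖p‖) :
    R ^ (n + 1) * ‖(-(1 / (2 * t)) * heatKernel n t p) • innerSL ℝ p‖ ≤
      (n + 2).factorial * Real.exp 2 := by
  have hσ := Real.sqrt_pos.2 ht
  set q := ‖p‖ / Real.sqrt t with hq
  have hq0 : 0 ≤ q := by positivity
  have hs : Real.sqrt t + ‖p‖ = Real.sqrt t * (1 + q) := by rw [hq]; field_simp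
  have hp' : ‖p‖ = Real.sqrt t * q := by rw [hq]; field_simp
  rw [norm_smul, innerSL_apply_norm, norm_mul, norm_neg, Real.norm_of_nonneg (heatKernel_pos n ht p).le,
    Real.norm_of_nonneg (by positivity : 0 ≤ 1 / (2 * t))]
  calc R ^ (n + 1) * (1 / (2 * t) * heatKernel n t p * ‖p‖)
      ≤ (Real.sqrt t * (1 + q)) ^ (n + 1) *
        (1 / (2 * t) * ((Real.sqrt t ^ n)⁻¹ * Real.exp (-q ^ 2 / 4)) * ‖p‖) := by
        rw [← hs]
        gcongr
        · have := (heatKernel_pos n ht p).le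
          positivity
        · exact heatKernel_le_sqrt n ht p
    _ = 1 / 2 * ((1 + q) ^ (n + 1) * q * Real.exp (-q ^ 2 / 4)) := by
        rw [hp']
        nth_rewrite 2 [← Real.sq_sqrt ht.le]
        rw [mul_pow]
        field_simp
        ring
    _ ≤ 1 * ((1 + q) ^ (n + 1) * (1 + q) * Real.exp (-q ^ 2 / 4)) := by
        gcongr
        · norm_num
        · linarith
    _ = (1 + q) ^ (n + 2) * Real.exp (-q ^ 2 / 4) := by ring
    _ ≤ _ := one_add_pow_mul_exp_le hq0 (n + 2)

lemma abs_heatKernel_sub_le (n : ℕ) {t R : ℝ} (ht : 0 < t) (hR : 0 < R)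
    {y z : EuclideanSpace ℝ (Fin n)} (hy : R ≤ Real.sqrt t + ‖y‖) (hz : ‖z‖ ≤ R / 2) :
    |heatKernel n t (y - z) - heatKernel n t y| ≤
      (n + 2).factorial * Real.exp 2 * (2 / R) ^ (n + 1) * ‖z‖ := by
  have h := (convex_closedBall y (R / 2)).norm_image_sub_le_of_norm_hasFDerivWithin_le
    (f := heatKernel n t) (C := (n + 2).factorial * Real.exp 2 * (2 / R) ^ (n + 1))
    (fun p _ => (hasFDerivAt_heatKernel n ht p).hasFDerivWithinAt) ?_
    (mem_closedBall_self (by positivity)) (y := y - z) (by simpa [dist_eq_norm] using hz)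
  · simpa using h
  · intro p hp
    have hp1 : ‖y‖ - ‖p‖ ≤ R / 2 := by
      rw [mem_closedBall, dist_comm, dist_eq_norm] at hp
      exact (norm_sub_norm_le _ _).trans hp
    have := pow_mul_norm_fderiv_heatKernel_le n ht (R := R / 2) (by positivity) p (by linarith)
    rw [mul_comm, ← le_div_iff₀ (by positivity)] at this
    refine this.trans_eq ?_
    rw [div_eq_mul_inv, ← inv_pow, inv_div]

lemma abs_heatS_le_of_bdd (n : ℕ) {t : ℝ} (ht : 0 < t) {ψ : EuclideanSpace ℝ (Fin n) → ℝ} {D : ℝ}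
    (hD : ∀ x, |ψ x| ≤ D) (y : EuclideanSpace ℝ (Fin n)) : |heatS n t ψ y| ≤ D := by
  have hint : Integrable fun z => heatKernel n t (y - z) := (integrable_heatKernel n ht).comp_sub_left y
  have h := norm_integral_le_of_norm_le (f := fun z => heatKernel n t (y - z) * ψ z)
    (hint.mul_const D) (Eventually.of_forall fun z => by
      rw [norm_mul, Real.norm_of_nonneg (heatKernel_pos n ht _).le]
      exact mul_le_mul_of_nonneg_left (hD z) (heatKernel_pos n ht _).le)
  rwa [integral_mul_const, integral_sub_left_eq_self (heatKernel n t), integral_heatKernel n ht,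
    one_mul] at h

/-- Pointwise bound of the integrand of the heat extension after subtracting the kernel at the
origin, for a point `y` at distance at least `X - √t` from the origin. -/
lemma norm_heatKernel_sub_mul_le (n : ℕ) {t X D s : ℝ} (ht : 0 < t) (hX : 0 < X) (hD0 : 0 ≤ D)
    {y z : EuclideanSpace ℝ (Fin n)} (hy : X ≤ Real.sqrt t + ‖y‖)
    (hs : ‖z‖ ^ (n + 1) * ‖s‖ ≤ D) :
    ‖(heatKernel n t (y - z) - heatKernel n t y) * s‖ ≤ (2 / X) ^ (n + 1) *
      ((n.factorial * Real.exp 2 + (n + 2).factorial * Real.exp 2) * (‖z‖ * ‖s‖) +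
        D * heatKernel n t (y - z)) := by
  have hGy := pow_mul_heatKernel_le n ht hX.le y hy
  have hdiff := abs_heatKernel_sub_le n (z := z) ht hX hy
  have hA0 : 0 < (n.factorial : ℝ) * Real.exp 2 := by positivity
  have hB0 : 0 < ((n + 2).factorial : ℝ) * Real.exp 2 := by positivity
  generalize (n.factorial : ℝ) * Real.exp 2 = A at *
  generalize ((n + 2).factorial : ℝ) * Real.exp 2 = B at *
  have hK := heatKernel_pos n ht (y - z)
  have hKy := heatKernel_pos n ht y
  generalize heatKernel n t (y - z) = k at *
  generalize heatKernel n t y = k₀ at *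
  have hP : 0 < (2 / X) ^ (n + 1) := by positivity
  have hzs : 0 ≤ ‖z‖ * ‖s‖ := by positivity
  rw [norm_mul, Real.norm_eq_abs (k - k₀)]
  rcases le_or_gt ‖z‖ (X / 2) with hz | hz
  · calc |k - k₀| * ‖s‖ ≤ B * (2 / X) ^ (n + 1) * ‖z‖ * ‖s‖ := by
          gcongr; exact hdiff hz
      _ = (2 / X) ^ (n + 1) * (B * (‖z‖ * ‖s‖)) := by ring
      _ ≤ _ := by
          gcongr
          nlinarith [mul_nonneg hA0.le hzs, mul_nonneg hD0 hK.le]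
  · have hsz : ‖s‖ ≤ (2 / X) ^ (n + 1) * D := by
      have h1 : (X / 2) ^ (n + 1) * ‖s‖ ≤ D := by
        refine le_trans ?_ hs
        gcongr
      rw [mul_comm, ← le_div_iff₀ (by positivity)] at h1
      refine h1.trans_eq ?_
      rw [div_eq_mul_inv, ← inv_pow, inv_div, mul_comm]
    have hone : 1 ≤ 2 / X * ‖z‖ := by
      rw [div_mul_eq_mul_div, le_div_iff₀ hX]; linarith
    have hG2 : k₀ ≤ A * (2 / X) ^ n := by
      rw [div_pow, mul_div_assoc', le_div_iff₀ (by positivity), mul_comm]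
      exact hGy.trans (le_mul_of_one_le_right hA0.le (one_le_pow₀ one_le_two))
    calc |k - k₀| * ‖s‖ ≤ (k + k₀) * ‖s‖ := by
          gcongr
          rw [abs_le]; constructor <;> linarith
      _ = k * ‖s‖ + k₀ * 1 * ‖s‖ := by ring
      _ ≤ k * ((2 / X) ^ (n + 1) * D) + A * (2 / X) ^ n * (2 / X * ‖z‖) * ‖s‖ := by gcongr
      _ = (2 / X) ^ (n + 1) * (A * (‖z‖ * ‖s‖) + D * k) := by ring
      _ ≤ _ := by
          gcongr
          linarith

lemma heatS_eq_integral_sub_mul (n : ℕ) {t : ℝ} (ht : 0 < t)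
    (ψ : SchwartzMap (EuclideanSpace ℝ (Fin n)) ℝ) (hψ : ∫ x, ψ x = 0)
    (y : EuclideanSpace ℝ (Fin n)) :
    heatS n t ψ y = ∫ z, (heatKernel n t (y - z) - heatKernel n t y) * ψ z := by
  simp_rw [sub_mul]
  rw [integral_sub, integral_const_mul, hψ, mul_zero, sub_zero, heatS]
  · exact SchwartzMap.integrable_bdd_mul (by fun_prop) (fun z => by
      rw [abs_of_pos (heatKernel_pos n ht _)]; exact heatKernel_le n ht (y - z)) ψ
  · exact ψ.integrable.const_mul _

/-- Decay of the heat extension of a mean-zero Schwartz function in parabolic cones. -/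
lemma exists_pow_mul_abs_heatS_le (n : ℕ) (ψ : SchwartzMap (EuclideanSpace ℝ (Fin n)) ℝ)
    (hψ : ∫ x, ψ x = 0) :
    ∃ C, ∀ (t : ℝ) (_ : 0 < t) (x y : EuclideanSpace ℝ (Fin n)), dist y x < Real.sqrt t →
      ‖x‖ ^ (n + 1) * |heatS n t ψ y| ≤ C := by
  obtain ⟨D, hD0, hD⟩ := ψ.decay (n + 1) 0
  simp only [norm_iteratedFDeriv_zero] at hD
  have hbound := fun t X y z (ht : 0 < t) hX hy =>
    norm_heatKernel_sub_mul_le n (s := ψ z) (y := y) (X := X) ht hX hD0.le hy (hD z)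
  have hE0 : 0 < (n.factorial * Real.exp 2 + (n + 2).factorial * Real.exp 2 : ℝ) := by positivity
  generalize (n.factorial * Real.exp 2 + (n + 2).factorial * Real.exp 2 : ℝ) = E at *
  have hM0 : 0 ≤ ∫ z, ‖z‖ * ‖ψ z‖ := integral_nonneg fun _ => by positivity
  have hintM : Integrable fun z => ‖z‖ * ‖ψ z‖ := by
    have h := ψ.integrable_pow_mul volume 1
    simp_rw [pow_one] at h
    exact h
  refine ⟨2 ^ (n + 1) * (E * (∫ z, ‖z‖ * ‖ψ z‖) + D), fun t ht x y hxy => ?_⟩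
  rcases (norm_nonneg x).eq_or_lt with hx | hx
  · rw [← hx, zero_pow n.succ_ne_zero, zero_mul]
    exact mul_nonneg (by positivity) (add_nonneg (mul_nonneg hE0.le hM0) hD0.le)
  have hy : ‖x‖ ≤ Real.sqrt t + ‖y‖ := by
    have : ‖x‖ - ‖y‖ ≤ dist y x := by
      rw [dist_comm, dist_eq_norm]; exact norm_sub_norm_le _ _
    linarith
  have hintK : Integrable fun z => heatKernel n t (y - z) :=
    (integrable_heatKernel n ht).comp_sub_left y
  have h := norm_integral_le_of_norm_le
    (((hintM.const_mul E).add (hintK.const_mul D)).const_mul ((2 / ‖x‖) ^ (n + 1)))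
    (Eventually.of_forall fun z => hbound t ‖x‖ y z ht hx hy)
  rw [← heatS_eq_integral_sub_mul n ht ψ hψ, integral_const_mul] at h
  simp only [Pi.add_apply] at h
  rw [integral_add (hintM.const_mul E) (hintK.const_mul D), integral_const_mul,
    integral_const_mul, integral_sub_left_eq_self (heatKernel n t), integral_heatKernel n ht,
    mul_one, Real.norm_eq_abs] at h
  calc ‖x‖ ^ (n + 1) * |heatS n t ψ y|
      ≤ ‖x‖ ^ (n + 1) * ((2 / ‖x‖) ^ (n + 1) * (E * (∫ z, ‖z‖ * ‖ψ z‖) + D)) := by gcongr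
    _ = _ := by rw [← mul_assoc, ← mul_pow, mul_div_cancel₀ _ hx.ne']

/-- A mean-zero Schwartz function has finite `H¹` norm. -/
lemma H1s_lt_top (n : ℕ) (ψ : SchwartzMap (EuclideanSpace ℝ (Fin n)) ℝ) (hψ : ∫ x, ψ x = 0) :
    H1s n ψ < ⊤ := by
  obtain ⟨C, hC⟩ := exists_pow_mul_abs_heatS_le n ψ hψ
  obtain ⟨D, hD0, hD⟩ := ψ.decay 0 0
  simp only [norm_iteratedFDeriv_zero, pow_zero, one_mul] at hD
  set K := 2 ^ (n + 1) * max C D with hK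
  have hK0 : 0 < K := by have := hD0.trans_le (le_max_right C D); positivity
  have hpt : ∀ x, heatMaximal n ψ x ≤
      ENNReal.ofReal K * ENNReal.ofReal ((1 + ‖x‖) ^ (-((n : ℝ) + 1))) := by
    intro x
    refine iSup₂_le fun t ht => iSup₂_le fun y hy => ?_
    rw [← ENNReal.ofReal_mul hK0.le]
    refine ENNReal.ofReal_le_ofReal ?_
    rw [Real.rpow_neg (by positivity), ← Nat.cast_add_one, Real.rpow_natCast, ← div_eq_mul_inv,
      le_div_iff₀ (by positivity), mul_comm]
    have h1 : (1 + ‖x‖) ^ (n + 1) ≤ 2 ^ (n + 1) * max 1 ‖x‖ ^ (n + 1) := by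
      rw [← mul_pow]
      gcongr
      linarith [le_max_left 1 ‖x‖, le_max_right 1 ‖x‖]
    calc _ ≤ 2 ^ (n + 1) * max 1 ‖x‖ ^ (n + 1) * |heatS n t ψ y| := by gcongr
      _ ≤ K := by
        rw [mul_assoc, hK]
        gcongr
        rcases le_total 1 ‖x‖ with h | h
        · rw [max_eq_right h]
          exact (hC t ht x y hy).trans (le_max_left _ _)
        · rw [max_eq_left h, one_pow, one_mul]
          exact (abs_heatS_le_of_bdd n ht hD y).trans (le_max_right _ _)
  rw [H1s_eq_lintegral]
  refine (lintegral_mono hpt).trans_lt ?_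
  rw [lintegral_const_mul' _ _ ENNReal.ofReal_ne_top]
  refine ENNReal.mul_lt_top ENNReal.ofReal_lt_top (finite_integral_one_add_norm ?_)
  simp

/-- for `φ` Schwartz with all vanishing moments (so `φ ∈ H¹` and `Δφ ∈ H¹`),
`A_t(φ) ≤ C min( t^{1/2} ‖Δφ‖_{H¹}, t^{-1/2} ‖φ‖_{H¹} )`; consequently `A_t(φ) → 0`
as `t → 0+` and as `t → ∞`. -/
theorem stmt14 (n : ℕ) (hn : 1 ≤ n) :
    ∃ C : ℝ≥0∞, 0 < C ∧ C ≠ ⊤ ∧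
      ∀ φ : SchwartzMap (EuclideanSpace ℝ (Fin n)) ℝ,
        (∀ α : Fin n → ℕ, ∫ x : EuclideanSpace ℝ (Fin n),
            (∏ i : Fin n, (x i) ^ (α i)) * φ x = 0) →
        (∀ t : ℝ, 0 < t →
          Afun n t ⇑φ ≤ C * min (ENNReal.ofReal (Real.sqrt t) * H1s n (lapF n ⇑φ))
            (ENNReal.ofReal ((Real.sqrt t)⁻¹) * H1s n ⇑φ)) ∧
        Tendsto (fun t : ℝ => Afun n t ⇑φ) (nhdsWithin 0 (Set.Ioi 0)) (nhds 0) ∧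
        Tendsto (fun t : ℝ => Afun n t ⇑φ) atTop (nhds 0) := by
  set K : ℝ≥0∞ := ENNReal.ofReal ((2 * n + 8) * Real.exp (1 / 4) * 8 ^ ((n : ℝ) / 2)) with hK
  have hCtop : max 1 K ≠ ⊤ := (max_lt ENNReal.one_lt_top ENNReal.ofReal_lt_top).ne
  refine ⟨max 1 K, zero_lt_one.trans_le (le_max_left _ _), hCtop, fun φ hφ => ?_⟩
  have hφ0 : ∫ x, φ x = 0 := by simpa using hφ 0
  have hH1 : H1s n φ ≠ ⊤ := (H1s_lt_top n φ hφ0).ne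
  have hH2 : H1s n (lapF n φ) ≠ ⊤ := by
    have h := integral_lapF_eq_zero n φ
    rw [lapF_eq_sum_lineDeriv] at h ⊢
    exact (H1s_lt_top n _ h).ne
  have hA : ∀ t : ℝ, Afun n t φ ≤ ENNReal.ofReal (Real.sqrt t) * H1s n (lapF n φ) :=
    fun t => Afun_le_sqrt_mul_H1s n φ
  have hB : ∀ t : ℝ, 0 < t → Afun n t φ ≤ K * (ENNReal.ofReal ((Real.sqrt t)⁻¹) * H1s n φ) :=
    fun t ht => Afun_le_inv_sqrt_mul_H1s n ht φ
  refine ⟨fun t ht => ?_, ?_, ?_⟩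
  · rw [mul_min]
    refine le_min ((hA t).trans ?_) ((hB t ht).trans ?_)
    · exact le_mul_of_one_le_left zero_le (le_max_left _ _)
    · gcongr
      exact le_max_right _ _
  · have h : Tendsto (fun t : ℝ => ENNReal.ofReal (Real.sqrt t) * H1s n (lapF n φ))
        (nhds 0) (nhds 0) := by
      have h0 : Tendsto (fun t : ℝ => ENNReal.ofReal (Real.sqrt t)) (nhds 0) (nhds 0) := by
        simpa using ENNReal.tendsto_ofReal (Real.continuous_sqrt.tendsto 0)
      simpa using ENNReal.Tendsto.mul_const h0 (Or.inr hH2)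
    exact tendsto_of_tendsto_of_tendsto_of_le_of_le tendsto_const_nhds
      (h.mono_left nhdsWithin_le_nhds) (fun _ => zero_le) hA
  · have h : Tendsto (fun t : ℝ => K * (ENNReal.ofReal ((Real.sqrt t)⁻¹) * H1s n φ))
        atTop (nhds 0) := by
      have h0 : Tendsto (fun t : ℝ => ENNReal.ofReal ((Real.sqrt t)⁻¹)) atTop (nhds 0) := by
        simpa using ENNReal.tendsto_ofReal (tendsto_inv_atTop_zero.comp Real.tendsto_sqrt_atTop)
      have h1 := ENNReal.Tendsto.mul_const h0 (Or.inr hH1)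
      rw [zero_mul] at h1
      have h2 := ENNReal.Tendsto.const_mul (a := K) h1 (Or.inr ENNReal.ofReal_ne_top)
      rwa [mul_zero] at h2
    exact tendsto_of_tendsto_of_tendsto_of_le_of_le' tendsto_const_nhds h
      (Eventually.of_forall fun _ => zero_le)
      ((eventually_gt_atTop 0).mono hB)
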